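/- arXiv:1811.09210 — 3 statements merged into one kernel-verified Lean document; each statement's English description precedes it below -/
import Mathlib

section
/- Let D be a Prüfer domain and let I be an ideal of D. Then I is idempotent (I² = I) if and only if I is a radical ideal and every prime ideal of D minimal over I is idempotent. -/
/-! Statement 2: In a Prüfer domain D, an ideal I is idempotent iff I is a radical ideal and every prime minimal over I is idempotent. -/

noncomputable section

/-- The image of an ideal of `D` in the fraction field of `D`, as a `D`-submodule. -/
def coeI (D : Type*) [CommRing D] [IsDomain D] (I : Ideal D) :
    Submodule D (FractionRing D) :=
  Submodule.map (Algebra.linearMap D (FractionRing D)) I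

/-- `D` is a Prüfer domain: every nonzero finitely generated ideal is invertible. -/
def IsPruferDom (D : Type*) [CommRing D] [IsDomain D] : Prop :=
  ∀ F : Ideal D, F ≠ ⊥ → F.FG → coeI D F * (1 / coeI D F) = 1

/-- The localization `D_P` of `D` at a prime `P`, viewed as a subset of the fraction field:
the set of fractions `a / s` with `s ∉ P`. -/
def locSet (D : Type*) [CommRing D] [IsDomain D] (P : Ideal D) : Set (FractionRing D) :=
  {x | ∃ a s : D, s ∉ P ∧ x * algebraMap D (FractionRing D) s = algebraMap D (FractionRing D) a}

/-- A maximal ideal `M` of `D` is sharp if `⋂ {D_N : N maximal, N ≠ M} ⊄ D_M`. -/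
def IsSharpMax (D : Type*) [CommRing D] [IsDomain D] (M : Ideal D) : Prop :=
  ¬ (⋂ N ∈ {N : Ideal D | N.IsMaximal ∧ N ≠ M}, locSet D N) ⊆ locSet D M

/-- A prime ideal `P` of `D` is branched if there is a `P`-primary ideal distinct from `P`. -/
def IsBranched (D : Type*) [CommRing D] [IsDomain D] (P : Ideal D) : Prop :=
  ∃ Q : Ideal D, Q.IsPrimary ∧ Q.radical = P ∧ Q ≠ P

/-- `D` has finite character: every nonzero element lies in only finitely many maximal ideals. -/
def FiniteCharacter (D : Type*) [CommRing D] [IsDomain D] : Prop :=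
  ∀ a : D, a ≠ 0 → {M : Ideal D | M.IsMaximal ∧ a ∈ M}.Finite

/-- A nonzero ideal `I` of `D` is divisorial if `(I⁻¹)⁻¹ = I`,
where `E⁻¹ = (D : E) = {x ∈ K : xE ⊆ D}`. -/
def IsDivisorial (D : Type*) [CommRing D] [IsDomain D] (I : Ideal D) : Prop :=
  (1 : Submodule D (FractionRing D)) / ((1 : Submodule D (FractionRing D)) / coeI D I) = coeI D I

/-- The saturation of an ideal `J` with respect to the complement of a prime ideal `M`, i.e. the
contraction to `D` of the extension of `J` to the localization at `M`. -/
def primeSaturation {D : Type*} [CommRing D] (M : Ideal D) [hM : M.IsPrime] (J : Ideal D) :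
    Ideal D where
  carrier := {x | ∃ s ∉ M, s * x ∈ J}
  zero_mem' := ⟨1, M.one_notMem, by simp⟩
  add_mem' := by
    rintro x y ⟨s, hs, hx⟩ ⟨t, ht, hy⟩
    refine ⟨s * t, hM.mul_notMem hs ht, ?_⟩
    have h := J.add_mem (J.mul_mem_left t hx) (J.mul_mem_left s hy)
    convert h using 1
    ring
  smul_mem' := by
    rintro c x ⟨s, hs, hx⟩
    refine ⟨s, hs, ?_⟩
    have h := J.mul_mem_left c hx
    rwa [mul_left_comm] at h

theorem primeSaturation_mono {D : Type*} [CommRing D] (M : Ideal D) [M.IsPrime] {J K : Ideal D}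
    (h : J ≤ K) : primeSaturation M J ≤ primeSaturation M K :=
  fun _ ⟨s, hs, hx⟩ => ⟨s, hs, h hx⟩

theorem le_primeSaturation_of_not_le {D : Type*} [CommRing D] {M : Ideal D} [M.IsPrime]
    {J : Ideal D} (h : ¬ J ≤ M) (K : Ideal D) : K ≤ primeSaturation M (J * K) := by
  obtain ⟨s, hsJ, hsM⟩ := SetLike.not_le_iff_exists.mp h
  exact fun x hx => ⟨s, hsM, Ideal.mul_mem_mul hsJ hx⟩

theorem primeSaturation_mul_le {D : Type*} [CommRing D] (M : Ideal D) [hM : M.IsPrime]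
    (J K : Ideal D) :
    primeSaturation M J * primeSaturation M K ≤ primeSaturation M (J * K) := by
  rw [Ideal.mul_le]
  rintro x ⟨s, hs, hx⟩ y ⟨t, ht, hy⟩
  refine ⟨s * t, hM.mul_notMem hs ht, ?_⟩
  rw [mul_mul_mul_comm]
  exact Ideal.mul_mem_mul hx hy

theorem le_of_forall_le_primeSaturation {D : Type*} [CommRing D] {J K : Ideal D}
    (h : ∀ (M : Ideal D) [M.IsMaximal], J ≤ primeSaturation M K) : J ≤ K := by
  intro x hx
  by_contra hxK
  have hne : Submodule.comap (LinearMap.mulRight D x) K ≠ ⊤ := fun htop =>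
    hxK (by simpa using (Ideal.eq_top_iff_one _).mp htop)
  obtain ⟨M, hM, hle⟩ := Ideal.exists_le_maximal _ hne
  obtain ⟨s, hs, hsx⟩ := h M hx
  exact hs (hle hsx)

/-- Any two elements of a Prüfer domain become comparable under divisibility after localizing at
a prime ideal. -/
theorem IsPruferDom.exists_notMem_dvd_or_dvd {D : Type*} [CommRing D] [IsDomain D]
    (hD : IsPruferDom D) (M : Ideal D) [hM : M.IsPrime] (a b : D) :
    ∃ s ∉ M, a ∣ s * b ∨ b ∣ s * a := by
  by_cases hF : Ideal.span {a, b} = ⊥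
  · have hb : b = 0 := by
      have : b ∈ Ideal.span {a, b} := Ideal.subset_span (by simp)
      simpa [hF] using this
    exact ⟨1, M.one_notMem, Or.inl (by simp [hb])⟩
  set φ := algebraMap D (FractionRing D)
  have hφ : Function.Injective φ := IsFractionRing.injective D (FractionRing D)
  have hinv := hD (Ideal.span {a, b}) hF (Submodule.fg_span (by simp))
  have hone : (1 : FractionRing D) ∈
      coeI D (Ideal.span {a, b}) * (1 / coeI D (Ideal.span {a, b})) := by
    rw [hinv]; exact Submodule.one_le.mp le_rfl
  have hspan : coeI D (Ideal.span {a, b}) =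
      Submodule.span D {φ a} ⊔ Submodule.span D {φ b} := by
    rw [coeI, Ideal.span, Submodule.map_span, Set.image_pair, Submodule.span_insert]
    rfl
  nth_rewrite 1 [hspan] at hone
  rw [Submodule.sup_mul] at hone
  obtain ⟨y, hy, z, hz, hyz⟩ := Submodule.mem_sup.mp hone
  obtain ⟨u, hu, rfl⟩ := Submodule.mem_span_singleton_mul.mp hy
  obtain ⟨v, hv, rfl⟩ := Submodule.mem_span_singleton_mul.mp hz
  have ha : φ a ∈ coeI D (Ideal.span {a, b}) :=
    Submodule.mem_map_of_mem (Ideal.subset_span (by simp))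
  have hb : φ b ∈ coeI D (Ideal.span {a, b}) :=
    Submodule.mem_map_of_mem (Ideal.subset_span (by simp))
  rw [Submodule.mem_div_iff_forall_mul_mem] at hu hv
  obtain ⟨ua, hua⟩ := Submodule.mem_one.mp (hu _ ha)
  obtain ⟨ub, hub⟩ := Submodule.mem_one.mp (hu _ hb)
  obtain ⟨va, hva⟩ := Submodule.mem_one.mp (hv _ ha)
  obtain ⟨vb, hvb⟩ := Submodule.mem_one.mp (hv _ hb)
  have hsum : ua + vb = 1 := hφ (by
    rw [map_add, map_one, hua, hvb, ← hyz]; ring)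
  by_cases hM' : ua ∈ M
  · refine ⟨vb, fun h => M.one_notMem (hsum ▸ M.add_mem hM' h), Or.inr ⟨va, hφ ?_⟩⟩
    rw [map_mul, map_mul, hva, hvb]; ring
  · refine ⟨ua, hM', Or.inl ⟨ub, hφ ?_⟩⟩
    rw [map_mul, map_mul, hua, hub]; ring

/-- A radical ideal of a Prüfer domain agrees with each of its minimal primes `P` after localizing
at any prime containing `P`. -/
theorem IsPruferDom.le_primeSaturation_of_mem_minimalPrimes {D : Type*} [CommRing D] [IsDomain D]
    (hD : IsPruferDom D) {I P M : Ideal D} [hM : M.IsPrime] (hI : I.IsRadical)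
    (hP : P ∈ I.minimalPrimes) (hPM : P ≤ M) : P ≤ primeSaturation M I := by
  have hPp : P.IsPrime := hP.1.1
  intro p hp
  have hp' := Ideal.mem_map_of_mem (algebraMap D (Localization.AtPrime P)) hp
  rw [← IsLocalization.AtPrime.radical_map_of_mem_minimalPrimes _ P I hP] at hp'
  obtain ⟨n, hn⟩ := hp'
  rw [← map_pow, IsLocalization.algebraMap_mem_map_algebraMap_iff P.primeCompl] at hn
  obtain ⟨u, hu, hn⟩ := hn
  have hup : u * p ∈ I := hI ⟨n + 1, by
    have h := I.mul_mem_left (u ^ n * p) hn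
    convert h using 1
    ring⟩
  obtain ⟨s, hs, ⟨c, hc⟩ | ⟨c, hc⟩⟩ := hD.exists_notMem_dvd_or_dvd M u p
  · refine ⟨s, hs, hI ⟨2, ?_⟩⟩
    have h := I.mul_mem_left (s * c) hup
    convert h using 1
    rw [sq]
    nth_rewrite 1 [hc]
    ring
  · exact absurd (hc ▸ P.mul_mem_right c hp) (hPp.mul_notMem (fun h => hs (hPM h)) hu)

theorem IsPruferDom.isRadical_of_mul_self_eq {D : Type*} [CommRing D] [IsDomain D]
    (hD : IsPruferDom D) {I : Ideal D} (hI : I * I = I) : I.IsRadical := by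
  rw [Ideal.isRadical_iff_pow_one_lt 2 one_lt_two]
  intro x hx
  by_cases hx0 : x = 0
  · simp [hx0]
  refine le_of_forall_le_primeSaturation (J := Ideal.span {x}) (fun M _ => ?_)
    (Ideal.mem_span_singleton_self x)
  rw [Ideal.span_singleton_le_iff_mem]
  by_contra hxM
  have hle : I ≤ primeSaturation M (Ideal.span {x}) := by
    intro a ha
    obtain ⟨s, hs, h | h⟩ := hD.exists_notMem_dvd_or_dvd M a x
    · exact absurd ⟨s, hs, I.mem_of_dvd h ha⟩ hxM
    · exact ⟨s, hs, Ideal.mem_span_singleton.mpr h⟩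
  have hIle : I ≤ primeSaturation M I := fun a ha => ⟨1, M.one_notMem, by simpa using ha⟩
  obtain ⟨s, hs, hsx⟩ := primeSaturation_mul_le M _ _ (Ideal.mul_mono hle hIle (hI.symm ▸ hx))
  obtain ⟨y, hy, hyx⟩ := Ideal.mem_span_singleton_mul.mp hsx
  refine hxM ⟨s, hs, ?_⟩
  have : y = s * x := mul_left_cancel₀ hx0 (by rw [hyx]; ring)
  exact this ▸ hy

theorem statement2 (D : Type*) [CommRing D] [IsDomain D]
    (hPruf : IsPruferDom D) (I : Ideal D) :
    I * I = I ↔ I.radical = I ∧ ∀ P ∈ I.minimalPrimes, P * P = P := by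
  constructor
  · intro hI
    have hrad := hPruf.isRadical_of_mul_self_eq hI
    refine ⟨hrad.radical, fun P hP => le_antisymm Ideal.mul_le_right ?_⟩
    refine le_of_forall_le_primeSaturation fun M _ => ?_
    by_cases hPM : P ≤ M
    · refine (hPruf.le_primeSaturation_of_mem_minimalPrimes hrad hP hPM).trans
        (primeSaturation_mono M ?_)
      exact hI.symm.le.trans (Ideal.mul_mono hP.1.2 hP.1.2)
    · exact le_primeSaturation_of_not_le hPM P
  · rintro ⟨hI, hmin⟩
    have hrad : I.IsRadical := Ideal.radical_eq_iff.mp hI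
    refine le_antisymm Ideal.mul_le_right (le_of_forall_le_primeSaturation fun M _ => ?_)
    by_cases hIM : I ≤ M
    · obtain ⟨P, hP, hPM⟩ := Ideal.exists_minimalPrimes_le hIM
      have hle := hPruf.le_primeSaturation_of_mem_minimalPrimes hrad hP hPM
      calc I ≤ P := hP.1.2
        _ = P * P := (hmin P hP).symm
        _ ≤ primeSaturation M I * primeSaturation M I := Ideal.mul_mono hle hle
        _ ≤ primeSaturation M (I * I) := primeSaturation_mul_le M I I
    · exact le_primeSaturation_of_not_le hIM I

end
end

section
/- Let D be a Prüfer domain with finite character and let I be a nonzero proper ideal of D. Then I is idempotent (I² = I) if and only if I is a product P₁⋯Pₙ of finitely many idempotent prime ideals P₁, …, Pₙ of D. -/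
/-! Statement 5: In a Prüfer domain with finite character, a nonzero proper ideal I is idempotent iff I is a product of finitely many idempotent prime ideals. -/

noncomputable section

/-- In a Prüfer domain, principal ideals become comparable locally at any maximal ideal. -/
theorem IsPruferDom.exists_notMem_dvd {D : Type*} [CommRing D] [IsDomain D]
    (h : IsPruferDom D) {M : Ideal D} (hM : M.IsMaximal) (a b : D) (hb : b ≠ 0) :
    ∃ s ∉ M, a ∣ s * b ∨ b ∣ s * a := by
  have hF : (1 : FractionRing D) ∈
      coeI D (Ideal.span {a, b}) * (1 / coeI D (Ideal.span {a, b})) := by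
    rw [h _ (fun hbot => hb ?_) (Submodule.fg_span (Set.toFinite _))]
    · exact Submodule.one_le.mp le_rfl
    · have : b ∈ Ideal.span {a, b} := Ideal.subset_span (by simp)
      simpa [hbot] using this
  have hmap : coeI D (Ideal.span {a, b}) =
      Submodule.span D {algebraMap D (FractionRing D) a} ⊔
        Submodule.span D {algebraMap D (FractionRing D) b} := by
    rw [coeI, Ideal.span, Submodule.map_span, Set.image_pair, Submodule.span_insert]
    rfl
  have hint : ∀ u ∈ 1 / coeI D (Ideal.span {a, b}), ∀ c ∈ Ideal.span {a, b},
      ∃ d : D, algebraMap D (FractionRing D) d = u * algebraMap D (FractionRing D) c := by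
    intro u hu c hc
    exact Submodule.mem_one.mp (Submodule.mem_div_iff_forall_mul_mem.mp hu _ ⟨c, hc, rfl⟩)
  have inj := IsFractionRing.injective D (FractionRing D)
  rw [hmap, Submodule.sup_mul] at hF
  obtain ⟨y, hy, z, hz, hyz⟩ := Submodule.mem_sup.mp hF
  obtain ⟨u, hu, rfl⟩ := Submodule.mem_span_singleton_mul.mp hy
  obtain ⟨v, hv, rfl⟩ := Submodule.mem_span_singleton_mul.mp hz
  rw [← hmap] at hu hv
  have ha' : a ∈ Ideal.span {a, b} := Ideal.subset_span (by simp)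
  have hb' : b ∈ Ideal.span {a, b} := Ideal.subset_span (by simp)
  obtain ⟨ua, hua⟩ := hint u hu a ha'
  obtain ⟨ub, hub⟩ := hint u hu b hb'
  obtain ⟨va, hva⟩ := hint v hv a ha'
  obtain ⟨vb, hvb⟩ := hint v hv b hb'
  have hsum : ua + vb = 1 := by
    apply inj
    rw [map_add, map_one, hua, hvb, ← hyz]
    ring
  by_cases hs : ua ∈ M
  · refine ⟨vb, fun hs' => ?_, Or.inr ⟨va, inj ?_⟩⟩
    · exact hM.ne_top ((Ideal.eq_top_iff_one M).mpr (hsum ▸ M.add_mem hs hs'))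
    · rw [map_mul, map_mul, hvb, hva]
      ring
  · refine ⟨ua, hs, Or.inl ⟨ub, inj ?_⟩⟩
    rw [map_mul, map_mul, hua, hub]
    ring

/-- Prime ideals of a Prüfer domain contained in a common maximal ideal are comparable. -/
theorem IsPruferDom.le_total_of_le_maximal {D : Type*} [CommRing D] [IsDomain D]
    (h : IsPruferDom D) {M P Q : Ideal D} (hM : M.IsMaximal) (hP : P.IsPrime) (hQ : Q.IsPrime)
    (hPM : P ≤ M) (hQM : Q ≤ M) : P ≤ Q ∨ Q ≤ P := by
  by_contra! hcon
  obtain ⟨a, haP, haQ⟩ := SetLike.not_le_iff_exists.mp hcon.1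
  obtain ⟨b, hbQ, hbP⟩ := SetLike.not_le_iff_exists.mp hcon.2
  obtain ⟨s, hs, hd | hd⟩ := h.exists_notMem_dvd hM a b (fun h0 => hbP (h0 ▸ P.zero_mem))
  · exact (hP.mem_or_mem (P.mem_of_dvd hd haP)).elim (fun hsP => hs (hPM hsP)) hbP
  · exact (hQ.mem_or_mem (Q.mem_of_dvd hd hbQ)).elim (fun hsQ => hs (hQM hsQ)) haQ

/-- Idempotent ideals of a Prüfer domain are radical. -/
theorem IsPruferDom.isRadical_of_mul_self {D : Type*} [CommRing D] [IsDomain D]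
    (h : IsPruferDom D) {I : Ideal D} (hI : I * I = I) : I.IsRadical := by
  refine (Ideal.isRadical_iff_pow_one_lt 2 one_lt_two).mpr fun x hx => ?_
  by_contra hxI
  have hx0 : x ≠ 0 := fun h0 => hxI (h0 ▸ I.zero_mem)
  obtain ⟨M, hM, hle⟩ := Ideal.exists_le_maximal (I.colon {x}) (fun htop => hxI (by
    have h1 : (1 : D) ∈ I.colon {x} := htop ▸ Submodule.mem_top
    simpa using Submodule.mem_colon_singleton.mp h1))
  have hxM : ∀ s ∉ M, s * x ∉ I := fun s hs hsx => hs (hle (Submodule.mem_colon_singleton.mpr hsx))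
  have hmul : ∀ {s t : D}, s ∉ M → t ∉ M → s * t ∉ M := fun hs ht hst =>
    (hM.isPrime.mem_or_mem hst).elim hs ht
  have hdiv : ∀ a ∈ I, ∃ s ∉ M, ∃ t ∈ M, s * a = x * t := by
    intro a ha
    obtain ⟨s, hs, hd | ⟨t, ht⟩⟩ := h.exists_notMem_dvd hM a x hx0
    · exact absurd (I.mem_of_dvd hd ha) (hxM s hs)
    · refine ⟨s, hs, t, ?_, ht⟩
      by_contra htM
      exact hxM t htM (by rw [mul_comm, ← ht]; exact I.mul_mem_left s ha)
  have hdiv2 : ∀ y ∈ I * I, ∃ s ∉ M, ∃ t ∈ M, s * y = x ^ 2 * t := by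
    intro y hy
    induction hy using Submodule.mul_induction_on' with
    | mem_mul_mem a ha b hb =>
      obtain ⟨s, hs, t, ht, hst⟩ := hdiv a ha
      obtain ⟨s', hs', t', ht', hst'⟩ := hdiv b hb
      exact ⟨s * s', hmul hs hs', t * t', M.mul_mem_left t ht', by
        linear_combination s' * b * hst + x * t * hst'⟩
    | add y _ z _ hy hz =>
      obtain ⟨s, hs, t, ht, hst⟩ := hy
      obtain ⟨s', hs', t', ht', hst'⟩ := hz
      exact ⟨s * s', hmul hs hs', s' * t + s * t',
        M.add_mem (M.mul_mem_left _ ht) (M.mul_mem_left _ ht'), by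
          linear_combination s' * hst + s * hst'⟩
  obtain ⟨s, hs, t, ht, hst⟩ := hdiv2 (x ^ 2) (hI.symm ▸ hx)
  rw [mul_comm] at hst
  exact hs (mul_left_cancel₀ (pow_ne_zero 2 hx0) hst ▸ ht)

/-- Minimal primes of an ideal of a Prüfer domain are equal if they lie in a common maximal
ideal. -/
theorem IsPruferDom.eq_of_mem_minimalPrimes {D : Type*} [CommRing D] [IsDomain D]
    (h : IsPruferDom D) {I M P Q : Ideal D} (hM : M.IsMaximal) (hP : P ∈ I.minimalPrimes)
    (hQ : Q ∈ I.minimalPrimes) (hPM : P ≤ M) (hQM : Q ≤ M) : P = Q := by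
  rcases h.le_total_of_le_maximal hM hP.1.1 hQ.1.1 hPM hQM with hle | hle
  · exact le_antisymm hle (hQ.2 hP.1 hle)
  · exact le_antisymm (hP.2 hQ.1 hle) hle

/-- A nonzero ideal of a Prüfer domain of finite character has finitely many minimal primes. -/
theorem IsPruferDom.finite_minimalPrimes {D : Type*} [CommRing D] [IsDomain D]
    (h : IsPruferDom D) (hfc : FiniteCharacter D) {I : Ideal D} (hI0 : I ≠ ⊥) :
    I.minimalPrimes.Finite := by
  obtain ⟨a, ha, ha0⟩ := Submodule.exists_mem_ne_zero_of_ne_bot hI0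
  have hex : ∀ P : Ideal D, ∃ M : Ideal D, P ∈ I.minimalPrimes → M.IsMaximal ∧ P ≤ M := by
    intro P
    by_cases hP : P ∈ I.minimalPrimes
    · obtain ⟨M, hM⟩ := P.exists_le_maximal hP.1.1.ne_top
      exact ⟨M, fun _ => hM⟩
    · exact ⟨⊥, fun hP' => absurd hP' hP⟩
  choose f hf using hex
  refine Set.Finite.of_finite_image ((hfc a ha0).subset ?_) (f := f) ?_
  · rintro _ ⟨P, hP, rfl⟩
    exact ⟨(hf P hP).1, (hf P hP).2 (hP.1.2 ha)⟩
  · intro P hP Q hQ hPQ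
    exact h.eq_of_mem_minimalPrimes (hf P hP).1 hP hQ (hf P hP).2 (hPQ ▸ (hf Q hQ).2)

/-- A factor of an idempotent product of two comaximal ideals is idempotent. -/
theorem Ideal.mul_self_eq_of_isCoprime {R : Type*} [CommSemiring R] {P J : Ideal R}
    (hPJ : IsCoprime P J) (h : (P * J) * (P * J) = P * J) : P * P = P := by
  refine le_antisymm Ideal.mul_le_left ?_
  calc P = P * (P ⊔ J) := by rw [Ideal.isCoprime_iff_sup_eq.mp hPJ, Ideal.mul_top]
    _ = P * P ⊔ (P * J) * (P * J) := by rw [Ideal.mul_sup, h]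
    _ ≤ P * P := sup_le le_rfl (Ideal.mul_mono Ideal.mul_le_left Ideal.mul_le_left)

theorem statement5 (D : Type*) [CommRing D] [IsDomain D]
    (hPruf : IsPruferDom D) (hfc : FiniteCharacter D)
    (I : Ideal D) (hI0 : I ≠ ⊥) (hItop : I ≠ ⊤) :
    I * I = I ↔
      ∃ s : Multiset (Ideal D), (∀ P ∈ s, P.IsPrime ∧ P * P = P) ∧ s.prod = I := by
  classical
  constructor
  · intro hI
    have hfin := hPruf.finite_minimalPrimes hfc hI0
    have hcop : ∀ P ∈ hfin.toFinset, ∀ Q ∈ hfin.toFinset, P ≠ Q → IsCoprime P Q := by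
      intro P hP Q hQ hne
      rw [Ideal.isCoprime_iff_sup_eq]
      by_contra htop
      obtain ⟨M, hM, hle⟩ := Ideal.exists_le_maximal _ htop
      exact hne (hPruf.eq_of_mem_minimalPrimes hM (hfin.mem_toFinset.mp hP)
        (hfin.mem_toFinset.mp hQ) (le_sup_left.trans hle) (le_sup_right.trans hle))
    have hprod : ∏ P ∈ hfin.toFinset, P = I := by
      rw [Ideal.prod_eq_iInf_of_pairwise_isCoprime fun P hP Q hQ => hcop P hP Q hQ]
      simp only [hfin.mem_toFinset]
      rw [← sInf_eq_iInf, Ideal.sInf_minimalPrimes, (hPruf.isRadical_of_mul_self hI).radical]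
    refine ⟨hfin.toFinset.val, fun P hP => ⟨(hfin.mem_toFinset.mp hP).1.1, ?_⟩, ?_⟩
    · refine Ideal.mul_self_eq_of_isCoprime (J := ∏ Q ∈ hfin.toFinset.erase P, Q) ?_ ?_
      · exact IsCoprime.prod_right fun Q hQ => hcop P hP Q (Finset.mem_of_mem_erase hQ)
          (Finset.ne_of_mem_erase hQ).symm
      · rw [Finset.mul_prod_erase _ (fun Q => Q) hP, hprod, hI]
    · exact (Finset.prod_val _).trans hprod
  · rintro ⟨s, hs, rfl⟩
    have : (s.map fun P => P * P).prod = (s.map fun P => P).prod :=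
      congrArg _ (Multiset.map_congr rfl fun P hP => (hs P hP).2)
    rwa [Multiset.prod_map_mul, Multiset.map_id'] at this

end
end

section
/- Let ⋆ be a semistar operation on an integral domain D with quotient field K. Then the equality (D^⋆ : E)·Na(D,⋆) = (Na(D,⋆) : E) holds for every nonzero D-submodule E of K if and only if D^⋆ ⊆ Na(D,⋆) (as subsets of the quotient field of D[X]). -/
/-! Statement 10: For a semistar operation ⋆ on D, the equality (D^⋆ : E)·Na(D,⋆) = (Na(D,⋆) : E) holds for every nonzero D-submodule E of K iff D^⋆ ⊆ Na(D,⋆) (as subsets of the quotient field of D[X]). -/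

open scoped Pointwise

noncomputable section

/-- A semistar operation on an integral domain `D` with quotient field `K`:
a map `E ↦ E^⋆` on nonzero `D`-submodules of `K` such that for all nonzero `x ∈ K`
and all nonzero `D`-submodules `E, F` of `K`:
`(xE)^⋆ = xE^⋆`; `E ⊆ F → E^⋆ ⊆ F^⋆`; `E ⊆ E^⋆`; and `(E^⋆)^⋆ = E^⋆`. -/
structure SemistarOp (D : Type*) [CommRing D] [IsDomain D] where
  star : Submodule D (FractionRing D) → Submodule D (FractionRing D)
  star_smul : ∀ x : FractionRing D, x ≠ 0 → ∀ E : Submodule D (FractionRing D), E ≠ ⊥ →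
    star (x • E) = x • star E
  star_mono : ∀ E F : Submodule D (FractionRing D), E ≠ ⊥ → F ≠ ⊥ → E ≤ F → star E ≤ star F
  le_star : ∀ E : Submodule D (FractionRing D), E ≠ ⊥ → E ≤ star E
  star_star : ∀ E : Submodule D (FractionRing D), E ≠ ⊥ → star (star E) = star E
/-- The natural embedding of the quotient field `K` of `D` into the quotient field `L`
of the polynomial ring `D[X]`. -/
def embK (D : Type*) [CommRing D] [IsDomain D] :
    FractionRing D →+* FractionRing (Polynomial D) :=
  IsFractionRing.lift
    (g := (algebraMap (Polynomial D) (FractionRing (Polynomial D))).comp Polynomial.C)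
    ((IsFractionRing.injective (Polynomial D) (FractionRing (Polynomial D))).comp
      (Polynomial.C_injective))

/-- The content `c(g)` of a polynomial `g ∈ D[X]`: the ideal of `D`
generated by the coefficients of `g`. -/
def contIdeal (D : Type*) [CommRing D] [IsDomain D] (g : Polynomial D) : Ideal D :=
  Ideal.span (Set.range g.coeff)

/-- `N(⋆) = {g ∈ D[X] : g ≠ 0 and c(g)^⋆ = D^⋆}`. -/
def Nstar (D : Type*) [CommRing D] [IsDomain D] (s : SemistarOp D) : Set (Polynomial D) :=
  {g | g ≠ 0 ∧ s.star (coeI D (contIdeal D g)) = s.star 1}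

/-- The semistar Nagata ring `Na(D,⋆) = D[X]_{N(⋆)}`, regarded as a subset of the
quotient field `L` of `D[X]`: the set of fractions `f / g` with `f ∈ D[X]`, `g ∈ N(⋆)`. -/
def NaSet (D : Type*) [CommRing D] [IsDomain D] (s : SemistarOp D) :
    Set (FractionRing (Polynomial D)) :=
  {x | ∃ f g : Polynomial D, g ∈ Nstar D s ∧
    x * algebraMap (Polynomial D) (FractionRing (Polynomial D)) g =
      algebraMap (Polynomial D) (FractionRing (Polynomial D)) f}

/-- The product `A·B` of two subsets of a commutative ring: the set of all finite sums of
products `a * b` with `a ∈ A`, `b ∈ B` (the additive submonoid generated by the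
pointwise product set). -/
def setMulSpan {R : Type*} [CommRing R] (A B : Set R) : Set R :=
  (AddSubmonoid.closure (A * B) : AddSubmonoid R)

section Content

open Polynomial

variable {R A : Type*} [CommRing R] [CommRing A] [Algebra R A]

/-- If `q * g` has coefficients in `M`, then so does `b ^ n • q`, with `b` the leading coefficient
of `g` and `n` large enough. -/
theorem exists_leadingCoeff_pow_smul_coeff_mem (M : Submodule R A) (g : R[X]) (q : A[X])
    (h : ∀ i, (q * g.map (algebraMap R A)).coeff i ∈ M) :
    ∃ n : ℕ, ∀ i, g.leadingCoeff ^ n • q.coeff i ∈ M := by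
  suffices key : ∀ (N : ℕ) (q : A[X]), (∀ i, N ≤ i → q.coeff i ∈ M) →
      (∀ i, (q * g.map (algebraMap R A)).coeff i ∈ M) →
      ∀ i, g.leadingCoeff ^ N • q.coeff i ∈ M by
    refine ⟨q.natDegree + 1, key _ q (fun i hi ↦ ?_) h⟩
    rw [coeff_eq_zero_of_natDegree_lt (by lia)]
    exact M.zero_mem
  intro N
  induction N with
  | zero => intro q hq _ i; simpa using hq i (Nat.zero_le i)
  | succ N ih =>
    intro q hq h i
    rw [pow_succ, mul_smul, ← coeff_smul]
    refine ih (g.leadingCoeff • q) (fun k hk ↦ ?_) (fun k ↦ ?_) i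
    · rw [coeff_smul]
      rcases hk.eq_or_lt with rfl | hk
      · have hmem : (N, g.natDegree) ∈
            Finset.HasAntidiagonal.antidiagonal (N + g.natDegree) := by simp
        have hsum := h (N + g.natDegree)
        rw [coeff_mul, ← Finset.add_sum_erase _ _ hmem] at hsum
        have hrest := (M.add_mem_iff_left (M.sum_mem fun x hx ↦ ?_)).1 hsum
        · simpa [Algebra.smul_def, mul_comm] using hrest
        · obtain ⟨a, b⟩ := x
          simp only [Finset.mem_erase, ne_eq, Prod.mk.injEq,
            Finset.HasAntidiagonal.mem_antidiagonal] at hx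
          rw [coeff_map, mul_comm, ← Algebra.smul_def]
          by_cases hb : g.natDegree < b
          · simp [coeff_eq_zero_of_natDegree_lt hb]
          · exact M.smul_mem _ (hq _ (by lia))
      · exact M.smul_mem _ (hq _ hk)
    · rw [smul_mul_assoc, coeff_smul]
      exact M.smul_mem _ (h k)

theorem exists_coeff_pow_smul_coeff_mem (M : Submodule R A) (g : R[X]) (q : A[X])
    (h : ∀ i, (q * g.map (algebraMap R A)).coeff i ∈ M) (j : ℕ) :
    ∃ n : ℕ, ∀ i, g.coeff j ^ n • q.coeff i ∈ M := by
  induction hc : g.support.card using Nat.strong_induction_on generalizing g q with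
  | _ c ihc =>
  by_cases hg : g = 0
  · exact ⟨1, by simp [hg]⟩
  by_cases hj : j = g.natDegree
  · subst hj; exact exists_leadingCoeff_pow_smul_coeff_mem M g q h
  obtain ⟨n, hn⟩ := exists_leadingCoeff_pow_smul_coeff_mem M g q h
  induction n generalizing q with
  | zero => exact ⟨0, by simpa using hn⟩
  | succ n ihn =>
    have hsmul : ∀ (r : R) (i : ℕ), ((r • q) * g.map (algebraMap R A)).coeff i ∈ M := by
      intro r i
      rw [smul_mul_assoc, coeff_smul]
      exact M.smul_mem _ (h i)
    obtain ⟨k, hk⟩ := ihn (g.leadingCoeff • q) (hsmul _) (fun i ↦ by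
      rw [coeff_smul, ← mul_smul, ← pow_succ]; exact hn i)
    obtain ⟨l, hl⟩ := ihc _ (hc ▸ eraseLead_support_card_lt hg) g.eraseLead (g.coeff j ^ k • q)
      (fun i ↦ by
        have hsub : g.eraseLead = g - C g.leadingCoeff * X ^ g.natDegree := by
          rw [C_mul_X_pow_eq_monomial, eq_sub_iff_add_eq,
            eraseLead_add_monomial_natDegree_leadingCoeff]
        rw [hsub, Polynomial.map_sub, mul_sub, coeff_sub]
        refine M.sub_mem (hsmul _ i) ?_
        rw [Polynomial.map_mul, Polynomial.map_pow, map_X, map_C, ← mul_assoc, coeff_mul_X_pow']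
        split_ifs
        · rw [coeff_mul_C, mul_comm, ← Algebra.smul_def, coeff_smul, smul_comm, ← coeff_smul]
          exact hk _
        · exact M.zero_mem) rfl
    refine ⟨l + k, fun i ↦ ?_⟩
    rw [eraseLead_coeff_of_ne _ hj] at hl
    rw [pow_add, mul_smul, ← coeff_smul]
    exact hl i

/-- A weak form of the Dedekind–Mertens lemma. -/
theorem exists_contentIdeal_pow_smul_coeff_mem (M : Submodule R A) (g : R[X]) (q : A[X])
    (h : ∀ i, (q * g.map (algebraMap R A)).coeff i ∈ M) :
    ∃ n : ℕ, ∀ r ∈ g.contentIdeal ^ n, ∀ i, r • q.coeff i ∈ M := by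
  let I : Ideal R := ⨅ i, M.comap (LinearMap.toSpanSingleton R A (q.coeff i))
  have hI : ∀ r, r ∈ I ↔ ∀ i, r • q.coeff i ∈ M := by simp [I, Submodule.mem_iInf]
  have hle : g.contentIdeal ≤ I.radical := by
    rw [contentIdeal_def, Ideal.span_le]
    intro r hr
    obtain ⟨j, -, rfl⟩ := mem_coeffs_iff.1 (Finset.mem_coe.1 hr)
    obtain ⟨n, hn⟩ := exists_coeff_pow_smul_coeff_mem M g q h j
    exact ⟨n, (hI _).2 hn⟩
  obtain ⟨n, hn⟩ := Ideal.exists_pow_le_of_le_radical_of_fg hle g.contentIdeal_FG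
  exact ⟨n, fun r hr ↦ (hI r).1 (hn hr)⟩

end Content

section Semistar

variable {D : Type*} [CommRing D] [IsDomain D]

theorem contIdeal_eq_contentIdeal (g : Polynomial D) : contIdeal D g = g.contentIdeal := by
  refine le_antisymm (Ideal.span_le.2 ?_) (Ideal.span_mono fun r hr ↦ ?_)
  · rintro _ ⟨i, rfl⟩
    exact g.coeff_mem_contentIdeal i
  · obtain ⟨j, -, rfl⟩ := Polynomial.mem_coeffs_iff.1 (Finset.mem_coe.1 hr)
    exact ⟨j, rfl⟩

theorem algebraMap_mem_coeI {I : Ideal D} {a : D} (ha : a ∈ I) :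
    algebraMap D (FractionRing D) a ∈ coeI D I := ⟨a, ha, rfl⟩

theorem coeI_mono {I J : Ideal D} (h : I ≤ J) : coeI D I ≤ coeI D J := Submodule.map_mono h

theorem coeI_ne_bot {I : Ideal D} (h : I ≠ ⊥) : coeI D I ≠ ⊥ := by
  obtain ⟨a, ha, ha0⟩ := Submodule.exists_mem_ne_zero_of_ne_bot h
  intro hbot
  have := algebraMap_mem_coeI ha
  rw [hbot, Submodule.mem_bot] at this
  exact ha0 (by simpa using this)

theorem coeI_top : coeI D ⊤ = 1 := by
  rw [coeI, Submodule.map_top, Submodule.one_eq_range]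

theorem coeI_le_one (I : Ideal D) : coeI D I ≤ 1 := coeI_top (D := D) ▸ coeI_mono le_top

namespace SemistarOp

variable (s : SemistarOp D)

theorem one_mem_star_one : (1 : FractionRing D) ∈ s.star 1 :=
  s.le_star 1 one_ne_zero (Submodule.mem_one.2 ⟨1, map_one _⟩)

theorem star_ne_bot {E : Submodule D (FractionRing D)} (hE : E ≠ ⊥) : s.star E ≠ ⊥ :=
  ne_bot_of_le_ne_bot hE (s.le_star E hE)

theorem star_coeI_of_le {I J : Ideal D} (hI : I ≠ ⊥) (h : I ≤ J)
    (hs : s.star (coeI D I) = s.star 1) : s.star (coeI D J) = s.star 1 := by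
  have hJ : J ≠ ⊥ := ne_bot_of_le_ne_bot hI h
  refine le_antisymm (s.star_mono _ _ (coeI_ne_bot hJ) one_ne_zero (coeI_le_one J)) ?_
  rw [← hs]
  exact s.star_mono _ _ (coeI_ne_bot hI) (coeI_ne_bot hJ) (coeI_mono h)

theorem star_coeI_mul {I J : Ideal D} (hI : I ≠ ⊥) (hJ : J ≠ ⊥)
    (hsI : s.star (coeI D I) = s.star 1) (hsJ : s.star (coeI D J) = s.star 1) :
    s.star (coeI D (I * J)) = s.star 1 := by
  have hIJ : coeI D (I * J) ≠ ⊥ := coeI_ne_bot (mul_ne_zero hI hJ)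
  refine le_antisymm (s.star_mono _ _ hIJ one_ne_zero (coeI_le_one _)) ?_
  rw [← hsI, ← s.star_star _ hIJ]
  refine s.star_mono _ _ (coeI_ne_bot hI) (s.star_ne_bot hIJ) ?_
  rintro _ ⟨a, ha, rfl⟩
  rw [Algebra.linearMap_apply]
  by_cases ha0 : algebraMap D (FractionRing D) a = 0
  · rw [ha0]; exact Submodule.zero_mem _
  have hle : algebraMap D (FractionRing D) a • coeI D J ≤ coeI D (I * J) := by
    rintro _ ⟨_, ⟨b, hb, rfl⟩, rfl⟩
    exact ⟨a * b, Ideal.mul_mem_mul ha hb, by simp⟩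
  have hne : algebraMap D (FractionRing D) a • coeI D J ≠ ⊥ := by
    obtain ⟨y, hy, hy0⟩ := Submodule.exists_mem_ne_zero_of_ne_bot (coeI_ne_bot hJ)
    exact Submodule.ne_bot_iff _ |>.2
      ⟨_, Submodule.smul_mem_pointwise_smul y _ _ hy, mul_ne_zero ha0 hy0⟩
  have hstar := s.star_mono _ _ hne hIJ hle
  rw [s.star_smul _ ha0 _ (coeI_ne_bot hJ), hsJ] at hstar
  simpa using hstar (Submodule.smul_mem_pointwise_smul _ _ _ s.one_mem_star_one)

theorem star_coeI_pow {I : Ideal D} (hI : I ≠ ⊥) (hs : s.star (coeI D I) = s.star 1) (n : ℕ) :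
    s.star (coeI D (I ^ n)) = s.star 1 := by
  induction n with
  | zero => rw [pow_zero, Ideal.one_eq_top, coeI_top]
  | succ n ih => rw [pow_succ]; exact s.star_coeI_mul (pow_ne_zero n hI) hI ih hs

theorem mem_star_one_of_mul_mem {I : Ideal D} (hI : I ≠ ⊥) (hs : s.star (coeI D I) = s.star 1)
    {z : FractionRing D} (hz : ∀ r ∈ I, r • z ∈ (1 : Submodule D (FractionRing D))) :
    z ∈ s.star 1 := by
  by_cases hz0 : z = 0
  · rw [hz0]; exact Submodule.zero_mem _
  have hle : z • coeI D I ≤ 1 := by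
    rintro _ ⟨_, ⟨b, hb, rfl⟩, rfl⟩
    simpa [Algebra.smul_def, mul_comm] using hz b hb
  have hne : z • coeI D I ≠ ⊥ := by
    obtain ⟨y, hy, hy0⟩ := Submodule.exists_mem_ne_zero_of_ne_bot (coeI_ne_bot hI)
    exact Submodule.ne_bot_iff _ |>.2
      ⟨_, Submodule.smul_mem_pointwise_smul y _ _ hy, mul_ne_zero hz0 hy0⟩
  have hstar := s.star_mono _ _ hne one_ne_zero hle
  rw [s.star_smul _ hz0 _ (coeI_ne_bot hI), hs] at hstar
  simpa using hstar (Submodule.smul_mem_pointwise_smul _ _ _ s.one_mem_star_one)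

end SemistarOp

variable {s : SemistarOp D}

theorem mem_Nstar_iff {g : Polynomial D} :
    g ∈ Nstar D s ↔ g ≠ 0 ∧ s.star (coeI D g.contentIdeal) = s.star 1 := by
  rw [Nstar, Set.mem_ofPred_eq, contIdeal_eq_contentIdeal]

theorem one_mem_Nstar : (1 : Polynomial D) ∈ Nstar D s :=
  mem_Nstar_iff.2 ⟨one_ne_zero, by rw [Polynomial.contentIdeal_one, coeI_top]⟩

theorem mul_mem_Nstar {f g : Polynomial D} (hf : f ∈ Nstar D s) (hg : g ∈ Nstar D s) :
    f * g ∈ Nstar D s := by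
  rw [mem_Nstar_iff] at hf hg ⊢
  have hf0 : f.contentIdeal ≠ ⊥ := by simpa using hf.1
  have hg0 : g.contentIdeal ≠ ⊥ := by simpa using hg.1
  obtain ⟨n, hn⟩ := Ideal.exists_pow_le_of_le_radical_of_fg
    (Polynomial.mul_contentIdeal_le_radical_contentIdeal_mul (p := f) (q := g))
    (f.contentIdeal_FG.mul g.contentIdeal_FG)
  exact ⟨mul_ne_zero hf.1 hg.1, s.star_coeI_of_le (pow_ne_zero n (mul_ne_zero hf0 hg0)) hn
    (s.star_coeI_pow (mul_ne_zero hf0 hg0) (s.star_coeI_mul hf0 hg0 hf.2 hg.2) n)⟩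

theorem algebraMap_mem_NaSet (f : Polynomial D) :
    algebraMap (Polynomial D) (FractionRing (Polynomial D)) f ∈ NaSet D s :=
  ⟨f, 1, one_mem_Nstar, by simp⟩

theorem mul_mem_NaSet {x y : FractionRing (Polynomial D)} (hx : x ∈ NaSet D s)
    (hy : y ∈ NaSet D s) : x * y ∈ NaSet D s := by
  obtain ⟨f, g, hg, hx⟩ := hx
  obtain ⟨f', g', hg', hy⟩ := hy
  exact ⟨f * f', g * g', mul_mem_Nstar hg hg', by rw [map_mul, map_mul, ← hx, ← hy]; ring⟩

theorem add_mem_NaSet {x y : FractionRing (Polynomial D)} (hx : x ∈ NaSet D s)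
    (hy : y ∈ NaSet D s) : x + y ∈ NaSet D s := by
  obtain ⟨f, g, hg, hx⟩ := hx
  obtain ⟨f', g', hg', hy⟩ := hy
  exact ⟨f * g' + f' * g, g * g', mul_mem_Nstar hg hg', by
    rw [map_mul, map_add, map_mul, map_mul, ← hx, ← hy]; ring⟩

theorem embK_algebraMap (d : D) : embK D (algebraMap D (FractionRing D) d) =
    algebraMap (Polynomial D) (FractionRing (Polynomial D)) (Polynomial.C d) :=
  IsFractionRing.lift_algebraMap _ d

/-- If `x = (b / a) f / g` and `x * y` lies in the Nagata ring, then the coefficients of the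
polynomial `(b / a) y f` over `K` lie in `D^⋆`. -/
theorem coeff_mul_mem_star_one {x : FractionRing (Polynomial D)} {f g : Polynomial D} {a b : D}
    (ha : a ≠ 0)
    (hx : x * embK D (algebraMap D _ a) * algebraMap _ _ g = embK D (algebraMap D _ b) *
      algebraMap _ _ f)
    {y : FractionRing D} (hxy : x * embK D y ∈ NaSet D s) (i : ℕ) :
    algebraMap D (FractionRing D) b * algebraMap D _ (f.coeff i) / algebraMap D _ a * y ∈
      s.star 1 := by
  have hinj : Function.Injective (algebraMap D (FractionRing D)) := IsFractionRing.injective _ _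
  obtain ⟨c, d, hd, rfl⟩ := IsFractionRing.div_surjective (A := D) y
  have hd0 : d ≠ 0 := nonZeroDivisors.ne_zero hd
  have ha' : algebraMap D (FractionRing D) a ≠ 0 := by simpa using ha
  have hd' : algebraMap D (FractionRing D) d ≠ 0 := by simpa using hd0
  obtain ⟨f', g', hg', hxy⟩ := hxy
  have hde : embK D (algebraMap D _ d) ≠ 0 := (map_ne_zero _).2 hd'
  have hpoly : Polynomial.C c * Polynomial.C b * f * g' =
      Polynomial.C a * Polynomial.C d * (f' * g) := by
    apply IsFractionRing.injective (Polynomial D) (FractionRing (Polynomial D))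
    simp only [map_mul, ← embK_algebraMap]
    rw [← hxy, map_div₀]
    field_simp
    linear_combination (-embK D (algebraMap D _ c) * algebraMap _ _ g') * hx
  let q : Polynomial (FractionRing D) := Polynomial.C (algebraMap D _ b * algebraMap D _ c /
    (algebraMap D _ a * algebraMap D _ d)) * f.map (algebraMap D _)
  have hq : q * g'.map (algebraMap D _) = (f' * g).map (algebraMap D _) := by
    have hmap := congrArg (Polynomial.map (algebraMap D (FractionRing D))) hpoly
    simp only [Polynomial.map_mul, Polynomial.map_C] at hmap ⊢
    have hC : Polynomial.C (algebraMap D (FractionRing D) a) *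
        Polynomial.C (algebraMap D (FractionRing D) d) ≠ 0 := by simp [ha, hd0]
    refine mul_left_cancel₀ hC ?_
    rw [← hmap]
    have hCq : Polynomial.C (algebraMap D (FractionRing D) a) *
        Polynomial.C (algebraMap D (FractionRing D) d) * q =
        Polynomial.C (algebraMap D (FractionRing D) c) *
        Polynomial.C (algebraMap D (FractionRing D) b) * f.map (algebraMap D _) := by
      simp only [q, ← mul_assoc, ← Polynomial.C_mul]
      congr 2
      field_simp
    rw [← mul_assoc, hCq]
  obtain ⟨n, hn⟩ := exists_contentIdeal_pow_smul_coeff_mem 1 g' q (fun i ↦ by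
    rw [hq, Polynomial.coeff_map]
    exact Submodule.algebraMap_mem _)
  have hg'' := mem_Nstar_iff.1 hg'
  have hne : g'.contentIdeal ≠ ⊥ := by simpa using hg''.1
  have hmem := s.mem_star_one_of_mul_mem (pow_ne_zero n hne) (s.star_coeI_pow hne hg''.2 n)
    (fun r hr ↦ hn r hr i)
  convert hmem using 1
  simp only [q, Polynomial.coeff_C_mul, Polynomial.coeff_map]
  field_simp

/-- The inclusion `(Na(D,⋆) : E) ⊆ (D^⋆ : E)·Na(D,⋆)`, which holds unconditionally. -/
theorem mem_setMulSpan_of_forall_mul_mem {E : Submodule D (FractionRing D)} (hE : E ≠ ⊥)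
    {x : FractionRing (Polynomial D)} (hx : ∀ y ∈ E, x * embK D y ∈ NaSet D s) :
    x ∈ setMulSpan
      (embK D '' ((s.star 1 / E : Submodule D (FractionRing D)) : Set (FractionRing D)))
      (NaSet D s) := by
  obtain ⟨e, he, he0⟩ := Submodule.exists_mem_ne_zero_of_ne_bot hE
  obtain ⟨f, g, hg, hfg⟩ := hx e he
  obtain ⟨a, b, hb, rfl⟩ := IsFractionRing.div_surjective (A := D) e
  have hb' : algebraMap D (FractionRing D) b ≠ 0 := by simpa using nonZeroDivisors.ne_zero hb
  have ha' : algebraMap D (FractionRing D) a ≠ 0 := fun h ↦ he0 (by simp [h])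
  have ha : a ≠ 0 := by simpa using ha'
  have hbe : embK D (algebraMap D _ b) ≠ 0 := (map_ne_zero _).2 hb'
  have hae : embK D (algebraMap D _ a) ≠ 0 := (map_ne_zero _).2 ha'
  have hge : algebraMap (Polynomial D) (FractionRing (Polynomial D)) g ≠ 0 := by simpa using hg.1
  have hx' : x * embK D (algebraMap D _ a) * algebraMap _ _ g = embK D (algebraMap D _ b) *
      algebraMap _ _ f := by
    rw [← hfg, map_div₀]
    field_simp
  have hsum : x = ∑ i ∈ f.support,
      embK D (algebraMap D (FractionRing D) b * algebraMap D _ (f.coeff i) / algebraMap D _ a) *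
        (algebraMap (Polynomial D) _ (Polynomial.X ^ i) / algebraMap _ _ g) := by
    have hf : algebraMap (Polynomial D) (FractionRing (Polynomial D)) f = ∑ i ∈ f.support,
        embK D (algebraMap D _ (f.coeff i)) * algebraMap (Polynomial D) _ (Polynomial.X ^ i) := by
      conv_lhs => rw [f.as_sum_support_C_mul_X_pow, map_sum]
      simp only [map_mul, embK_algebraMap]
    have hdiv : x = embK D (algebraMap D _ b) * algebraMap _ _ f /
        (embK D (algebraMap D _ a) * algebraMap _ _ g) := by
      rw [← hx']; field_simp
    rw [hdiv, hf, Finset.mul_sum, Finset.sum_div]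
    refine Finset.sum_congr rfl fun i _ ↦ ?_
    rw [map_div₀, map_mul]
    field_simp
  rw [hsum]
  refine AddSubmonoid.sum_mem _ fun i _ ↦ AddSubmonoid.subset_closure
    (Set.mul_mem_mul ⟨_, ?_, rfl⟩ ⟨Polynomial.X ^ i, g, hg, div_mul_cancel₀ _ hge⟩)
  exact Submodule.mem_div_iff_forall_mul_mem.2 fun y hy ↦
    coeff_mul_mem_star_one ha hx' (hx y hy) i

end Semistar

theorem statement10 (D : Type*) [CommRing D] [IsDomain D] (s : SemistarOp D) :
    (∀ E : Submodule D (FractionRing D), E ≠ ⊥ →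
        setMulSpan
          (embK D '' ((s.star 1 / E : Submodule D (FractionRing D)) : Set (FractionRing D)))
          (NaSet D s) =
        {x : FractionRing (Polynomial D) |
          ∀ y ∈ embK D '' (E : Set (FractionRing D)), x * y ∈ NaSet D s}) ↔
      embK D '' ((s.star 1 : Submodule D (FractionRing D)) : Set (FractionRing D)) ⊆
        NaSet D s := by
  constructor
  · intro h
    rintro _ ⟨z, hz, rfl⟩
    have hmem : embK D z ∈ setMulSpan
        (embK D '' ((s.star 1 / 1 : Submodule D (FractionRing D)) : Set (FractionRing D)))
        (NaSet D s) := by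
      refine AddSubmonoid.subset_closure ⟨embK D z, ⟨z, ?_, rfl⟩, 1, ?_, mul_one _⟩
      · refine Submodule.mem_div_iff_forall_mul_mem.2 fun y hy ↦ ?_
        obtain ⟨d, rfl⟩ := Submodule.mem_one.1 hy
        rw [mul_comm, ← Algebra.smul_def]
        exact Submodule.smul_mem _ d hz
      · simpa using algebraMap_mem_NaSet (s := s) 1
    rw [h 1 one_ne_zero] at hmem
    simpa using hmem _ ⟨1, (Submodule.mem_one.2 ⟨1, map_one _⟩), rfl⟩
  · intro h E hE
    refine Set.Subset.antisymm ?_ fun x hx ↦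
      mem_setMulSpan_of_forall_mul_mem hE fun y hy ↦ hx _ ⟨y, hy, rfl⟩
    rintro x hx _ ⟨y, hy, rfl⟩
    refine AddSubmonoid.closure_induction (motive := fun x _ ↦ x * embK D y ∈ NaSet D s)
      ?_ ?_ ?_ hx
    · rintro _ ⟨_, ⟨z, hz, rfl⟩, w, hw, rfl⟩
      have hzy := h ⟨z * y, Submodule.mem_div_iff_forall_mul_mem.1 hz y hy, rfl⟩
      have := mul_mem_NaSet hzy hw
      rwa [map_mul, mul_right_comm] at this
    · simpa using algebraMap_mem_NaSet (s := s) 0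
    · intro u v _ _ hu hv
      rw [add_mul]
      exact add_mem_NaSet hu hv

end
end
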